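/- Let G = ⟨a,b_1,…,b_r⟩ be a multi-GGS-group with r ≥ 2. Then ψ₂(st_G(r+3)) is contained in st_G(r+1) × ⋯ × st_G(r+1) (p² factors), and consequently ψ₂(st_G(r+3)) ≤ G′ × ⋯ × G′ (p² factors). -/

import Mathlib

/-!
Automorphisms of the `p`-regular rooted tree, encoded by portraits:
an automorphism is a family of permutations of `Fin p`, one for each vertex
(vertices are finite words over `Fin p`, the root being `[]`).
-/

namespace TreeAut

variable {p : ℕ}

/-- Automorphisms of the `p`-regular rooted tree, given by their portraits. -/
def AutT (p : ℕ) : Type := List (Fin p) → Equiv.Perm (Fin p)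

namespace AutT

/-- The action of a tree automorphism on the vertices (finite words over `Fin p`). -/
def act : AutT p → List (Fin p) → List (Fin p)
  | _, [] => []
  | f, x :: w => f [] x :: act (fun v => f (x :: v)) w

/-- The section of `f` at the level-one vertex `x`; the map
`f ↦ (sections f 0, …, sections f (p-1))` restricted to the first-level
stabilizer is the isomorphism `ψ`. -/
def sections (f : AutT p) : Fin p → AutT p := fun x v => f (x :: v)

instance : One (AutT p) := ⟨fun _ => 1⟩

instance : Mul (AutT p) := ⟨fun f g v => f (act g v) * g v⟩

/-- The action of the inverse automorphism on vertices. -/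
def invAct : AutT p → List (Fin p) → List (Fin p)
  | _, [] => []
  | f, x :: w => (f [])⁻¹ x :: invAct (fun v => f (((f [])⁻¹ x) :: v)) w

instance : Inv (AutT p) := ⟨fun f v => (f (invAct f v))⁻¹⟩

lemma one_apply (v : List (Fin p)) : (1 : AutT p) v = 1 := rfl

lemma mul_apply (f g : AutT p) (v : List (Fin p)) : (f * g) v = f (act g v) * g v := rfl

lemma inv_apply (f : AutT p) (v : List (Fin p)) : f⁻¹ v = (f (invAct f v))⁻¹ := rfl

lemma act_nil (f : AutT p) : act f [] = [] := rfl

lemma act_cons (f : AutT p) (x : Fin p) (w : List (Fin p)) :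
    act f (x :: w) = f [] x :: act (sections f x) w := rfl

lemma sections_mul (f g : AutT p) (x : Fin p) :
    sections (f * g) x = sections f (g [] x) * sections g x :=
  funext fun _ => rfl

lemma act_one : ∀ v : List (Fin p), act (1 : AutT p) v = v
  | [] => rfl
  | x :: w => congrArg (x :: ·) (act_one w)

lemma act_mul (f g : AutT p) : ∀ v : List (Fin p), act (f * g) v = act f (act g v)
  | [] => rfl
  | x :: w => by
      rw [act_cons (f * g), sections_mul, act_mul, act_cons g, act_cons f]
      rfl

lemma invAct_act (f : AutT p) : ∀ v : List (Fin p), invAct f (act f v) = v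
  | [] => rfl
  | x :: w => by
      rw [act_cons]
      show (f [])⁻¹ (f [] x) ::
          invAct (fun v => f (((f [])⁻¹ (f [] x)) :: v)) (act (sections f x) w) = x :: w
      have key : ∀ y : Fin p, x = y →
          y :: invAct (fun v => f (y :: v)) (act (sections f x) w) = x :: w := by
        intro y hy
        subst hy
        exact congrArg (x :: ·) (invAct_act (sections f x) w)
      exact key _ ((f []).symm_apply_apply x).symm

instance : Group (AutT p) where
  mul_assoc f g h := by
    funext v
    show (f * g) (act h v) * h v = f (act (g * h) v) * (g * h) v
    rw [mul_apply, mul_apply, act_mul, mul_assoc]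
  one_mul f := by
    funext v
    show (1 : AutT p) (act f v) * f v = f v
    rw [one_apply, one_mul]
  mul_one f := by
    funext v
    show f (act (1 : AutT p) v) * (1 : AutT p) v = f v
    rw [act_one, one_apply, mul_one]
  inv_mul_cancel f := by
    funext v
    show f⁻¹ (act f v) * f v = (1 : AutT p) v
    rw [inv_apply, invAct_act, one_apply, inv_mul_cancel]

lemma act_length (f : AutT p) : ∀ v : List (Fin p), (act f v).length = v.length
  | [] => rfl
  | _ :: w => congrArg Nat.succ (act_length _ w)

lemma act_act_inv (f : AutT p) (v : List (Fin p)) : act f (act f⁻¹ v) = v := by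
  rw [← act_mul, mul_inv_cancel, act_one]

/-- The pointwise stabilizer `st(n)` of the `n`-th level of the tree. -/
def levelStab (p n : ℕ) : Subgroup (AutT p) where
  carrier := {f | ∀ v : List (Fin p), v.length = n → act f v = v}
  one_mem' := fun v _ => act_one v
  mul_mem' := by
    intro f g hf hg v hv
    rw [act_mul, hg v hv, hf v hv]
  inv_mem' := by
    intro f hf v hv
    have h1 : act f (act f⁻¹ v) = v := act_act_inv f v
    have h2 : act f (act f⁻¹ v) = act f⁻¹ v := hf _ (by rw [act_length, hv])
    exact h2.symm.trans h1

instance levelStab_normal (p n : ℕ) : (levelStab p n).Normal := by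
  constructor
  intro f hf g v hv
  show act (g * f * g⁻¹) v = v
  rw [act_mul, act_mul, hf _ (by rw [act_length, hv]), act_act_inv]

/-- The tuple of sections at the level-two vertices.  Restricted to the
second-level stabilizer this is the map `ψ₂`. -/
def sections2 (f : AutT p) : Fin p → Fin p → AutT p := fun x y v => f (x :: y :: v)

/-- The rooted automorphism defined by a permutation `σ` of `Fin p`. -/
def rooted (σ : Equiv.Perm (Fin p)) : AutT p := fun v => if v = [] then σ else 1

/-- The rooted automorphism `a`, acting at the root by the cycle `(1 2 … p)`. -/
def rootedA (p : ℕ) : AutT p := rooted (finRotate p)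

/-- Auxiliary portrait for the directed automorphism `b_e`. -/
def directedAux (e : Fin (p - 1) → ZMod p) : List (Fin p) → Equiv.Perm (Fin p)
  | [] => 1
  | x :: w =>
      if h : (x : ℕ) < p - 1 then
        (if w = [] then finRotate p ^ ((e ⟨x, h⟩).val) else 1)
      else directedAux e w

/-- The directed automorphism `b_e` defined by the vector `e ∈ 𝔽_p^{p-1}`,
i.e. the unique automorphism with `ψ(b_e) = (a^{e_1}, …, a^{e_{p-1}}, b_e)`. -/
def directed (e : Fin (p - 1) → ZMod p) : AutT p := directedAux e

/-- The multi-GGS-group determined by the vectors `e 1, …, e r`. -/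
def multiGGS (p : ℕ) {r : ℕ} (e : Fin r → Fin (p - 1) → ZMod p) : Subgroup (AutT p) :=
  Subgroup.closure ({rootedA p} ∪ Set.range fun i => directed (e i))

/-- The GGS-group `𝒢` defined by the (nonzero) constant vector `(c, …, c)`. -/
def constGGS (p : ℕ) (c : ZMod p) : Subgroup (AutT p) :=
  Subgroup.closure {rootedA p, directed (fun _ => c)}

/-- `G` is the GGS-group `𝒢` defined by a constant vector. -/
def IsConstGGS {p : ℕ} (G : Subgroup (AutT p)) : Prop :=
  ∃ c : ZMod p, c ≠ 0 ∧ G = constGGS p c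

/-- The stabilizer `st_G(n) = G ∩ st(n)`, viewed as a subgroup of `G`. -/
def stabIn {p : ℕ} (G : Subgroup (AutT p)) (n : ℕ) : Subgroup G :=
  (levelStab p n).comap G.subtype

instance {p : ℕ} (G : Subgroup (AutT p)) (n : ℕ) : (stabIn G n).Normal :=
  Subgroup.Normal.comap (levelStab_normal p n) G.subtype

/-- The congruence subgroup property: every finite-index subgroup of `G`
contains a level stabilizer `st_G(n)`. -/
def HasCSP {p : ℕ} (G : Subgroup (AutT p)) : Prop :=
  ∀ H : Subgroup G, H.FiniteIndex → ∃ n : ℕ, stabIn G n ≤ H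

/-- `G` is just infinite: it is infinite and all its nontrivial normal
subgroups have finite index. -/
def JustInfinite {p : ℕ} (G : Subgroup (AutT p)) : Prop :=
  Infinite G ∧ ∀ N : Subgroup G, N.Normal → N ≠ ⊥ → N.FiniteIndex

end AutT

end TreeAut

open TreeAut AutT Subgroup

namespace TreeAut

namespace AutT

/-! ### Powers of the rotation and additivity of directed automorphisms -/

section Basic

variable {p : ℕ}

lemma sections_one (x : Fin p) : sections (1 : AutT p) x = 1 := rfl

lemma sections_rooted (σ : Equiv.Perm (Fin p)) (x : Fin p) : sections (rooted σ) x = 1 := by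
  funext v
  simp [sections, rooted, one_apply]

lemma rooted_one : rooted (1 : Equiv.Perm (Fin p)) = 1 := by
  funext v
  simp [rooted, one_apply]

lemma act_eq_nil_iff (f : AutT p) (v : List (Fin p)) : act f v = [] ↔ v = [] := by
  rw [← List.length_eq_zero_iff, act_length, List.length_eq_zero_iff]

lemma rooted_mul (σ τ : Equiv.Perm (Fin p)) : rooted (σ * τ) = rooted σ * rooted τ := by
  funext v
  rw [mul_apply]
  simp only [rooted, act_eq_nil_iff]
  split_ifs <;> simp

lemma rootedA_pow (k : ℕ) : rootedA p ^ k = rooted (finRotate p ^ k) := by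
  induction k with
  | zero => rw [pow_zero, pow_zero, rooted_one]
  | succ k ih => rw [pow_succ, ih, pow_succ, rooted_mul]; rfl

lemma sections_directed_of_lt (u : Fin (p - 1) → ZMod p) (x : Fin p) (h : (x : ℕ) < p - 1) :
    sections (directed u) x = rootedA p ^ (u ⟨x, h⟩).val := by
  rw [rootedA_pow]
  funext v
  simp [sections, directed, directedAux, h, rooted]

lemma sections_directed_of_not_lt (u : Fin (p - 1) → ZMod p) (x : Fin p)
    (h : ¬ (x : ℕ) < p - 1) : sections (directed u) x = directed u := by
  funext v
  simp [sections, directed, directedAux, h]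

lemma directed_nil (u : Fin (p - 1) → ZMod p) : directed u [] = 1 := rfl

lemma nil_eq_one_of_mem_levelStab {n : ℕ} {f : AutT p} (hf : f ∈ levelStab p (n + 1)) :
    f [] = 1 := by
  ext1 x
  have h := hf (x :: List.replicate n x) (by simp)
  rw [act_cons] at h
  exact (List.cons.inj h).1

lemma sections_mem_levelStab {n : ℕ} {f : AutT p} (hf : f ∈ levelStab p (n + 1)) (x : Fin p) :
    sections f x ∈ levelStab p n := by
  intro v hv
  have h := hf (x :: v) (by simp [hv])
  rw [act_cons] at h
  exact (List.cons.inj h).2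

lemma inv_nil (f : AutT p) : f⁻¹ [] = (f [])⁻¹ := rfl

lemma sections_inv (f : AutT p) (x : Fin p) :
    sections f⁻¹ x = (sections f ((f [])⁻¹ x))⁻¹ := by
  rw [eq_inv_iff_mul_eq_one, ← sections_one ((f [])⁻¹ x), ← inv_mul_cancel f, sections_mul]
  simp

variable [NeZero p]

lemma finRotate_pow_apply (k : ℕ) (x : Fin p) : (finRotate p ^ k) x = x + Fin.ofNat p k := by
  induction k with
  | zero => simp
  | succ k ih =>
    rw [pow_succ', Equiv.Perm.mul_apply, ih, finRotate_apply]
    ext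
    simp [Fin.val_add, add_assoc]

lemma finRotate_pow_val_apply (n : ZMod p) (x : Fin p) :
    (finRotate p ^ n.val) x = x + (ZMod.finEquiv p).symm n := by
  obtain ⟨q, rfl⟩ := Nat.exists_eq_succ_of_ne_zero (NeZero.ne p)
  rw [finRotate_pow_apply]
  congr 1
  ext
  exact Nat.mod_eq_of_lt n.val_lt

lemma finRotate_pow_val_add (m n : ZMod p) :
    finRotate p ^ (m + n).val = finRotate p ^ m.val * finRotate p ^ n.val := by
  ext1 x
  rw [Equiv.Perm.mul_apply]
  simp only [finRotate_pow_val_apply, map_add]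
  abel

lemma rootedA_pow_val_add (m n : ZMod p) :
    rootedA p ^ (m + n).val = rootedA p ^ m.val * rootedA p ^ n.val := by
  simp only [rootedA_pow, finRotate_pow_val_add, rooted_mul]

lemma directed_add (u v : Fin (p - 1) → ZMod p) :
    directed (u + v) = directed u * directed v := by
  funext w
  induction w with
  | nil => simp [mul_apply, act_nil, directed_nil]
  | cons x w ih =>
    change sections (directed (u + v)) x w = sections (directed u * directed v) x w
    rw [sections_mul, directed_nil, Equiv.Perm.one_apply]
    by_cases h : (x : ℕ) < p - 1
    · simp only [sections_directed_of_lt _ x h, Pi.add_apply, rootedA_pow_val_add]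
    · simpa only [sections_directed_of_not_lt _ x h] using ih

lemma directed_zero : directed (0 : Fin (p - 1) → ZMod p) = 1 := by
  have h := directed_add (0 : Fin (p - 1) → ZMod p) 0
  rw [add_zero] at h
  exact left_eq_mul.mp h

lemma directed_neg (u : Fin (p - 1) → ZMod p) : directed (-u) = (directed u)⁻¹ := by
  rw [eq_inv_iff_mul_eq_one, ← directed_add, neg_add_cancel, directed_zero]

lemma rootedA_pow_val_neg (n : ZMod p) : rootedA p ^ (-n).val = (rootedA p ^ n.val)⁻¹ := by
  rw [eq_inv_iff_mul_eq_one, ← rootedA_pow_val_add, neg_add_cancel, ZMod.val_zero, pow_zero]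

end Basic

/-! ### Shift operators on `Fin p → ZMod p` -/

section Shift

variable {p : ℕ}

/-- The cyclic shift by `c` of a vector indexed by `Fin p`. -/
def shift (c : Fin p) : (Fin p → ZMod p) →ₗ[ZMod p] (Fin p → ZMod p) :=
  LinearMap.funLeft (ZMod p) (ZMod p) fun x => x - c

lemma shift_apply (c : Fin p) (f : Fin p → ZMod p) (x : Fin p) : shift c f x = f (x - c) := rfl

/-- Extension of a vector of length `p - 1` by a zero in the last coordinate. -/
def extend : (Fin (p - 1) → ZMod p) →ₗ[ZMod p] (Fin p → ZMod p) where
  toFun u x := if h : (x : ℕ) < p - 1 then u ⟨x, h⟩ else 0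
  map_add' u v := by
    funext x
    by_cases h : (x : ℕ) < p - 1 <;> simp [h]
  map_smul' c u := by
    funext x
    by_cases h : (x : ℕ) < p - 1 <;> simp [h]

lemma extend_of_lt (u : Fin (p - 1) → ZMod p) (x : Fin p) (h : (x : ℕ) < p - 1) :
    extend u x = u ⟨x, h⟩ := dif_pos h

lemma extend_of_not_lt (u : Fin (p - 1) → ZMod p) (x : Fin p) (h : ¬ (x : ℕ) < p - 1) :
    extend u x = 0 := dif_neg h

lemma extend_eq_zero {u : Fin (p - 1) → ZMod p} (h : extend u = 0) : u = 0 := by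
  funext i
  have hi : (i : ℕ) < p := lt_of_lt_of_le i.isLt (Nat.sub_le p 1)
  rw [← extend_of_lt u ⟨i, hi⟩ i.isLt, h]
  rfl

variable [NeZero p]

lemma shift_one_pow (k : ℕ) : (shift (1 : Fin p)) ^ k = shift (Fin.ofNat p k) := by
  induction k with
  | zero =>
    ext1 f
    ext x
    simp [shift_apply]
  | succ k ih =>
    rw [pow_succ, ih]
    apply LinearMap.ext
    intro f
    funext x
    rw [Module.End.mul_apply, shift_apply, shift_apply, shift_apply]
    congr 1
    rw [sub_sub]
    congr 1
    ext
    simp [Fin.val_add]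

lemma shift_sub_one_pow_card [Fact p.Prime] : (shift (1 : Fin p) - 1) ^ p = 0 := by
  have : CharP (Module.End (ZMod p) (Fin p → ZMod p)) p := by
    exact charP_of_injective_algebraMap
      (algebraMap (ZMod p) (Module.End (ZMod p) (Fin p → ZMod p))).injective p
  rw [sub_pow_char_of_commute _ (Commute.one_right _), one_pow, sub_eq_zero, shift_one_pow]
  apply LinearMap.ext
  intro f
  funext x
  rw [shift_apply]
  have : Fin.ofNat p p = 0 := by ext; simp
  rw [this, sub_zero, Module.End.one_apply]

lemma shift_sub_one_pow_shift {j : ℕ} {v : Fin p → ZMod p}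
    (hv : ((shift (1 : Fin p) - 1) ^ (j + 1)) v = 0) (c : Fin p) :
    ((shift (1 : Fin p) - 1) ^ j) (shift c v) = ((shift (1 : Fin p) - 1) ^ j) v := by
  have key (k : ℕ) :
      ((shift (1 : Fin p) - 1) ^ j * shift (1 : Fin p) ^ k) v
        = ((shift (1 : Fin p) - 1) ^ j) v := by
    induction k with
    | zero => simp
    | succ k ih =>
      have hcomm : Commute ((shift (1 : Fin p) - 1) ^ (j + 1)) (shift (1 : Fin p) ^ k) :=
        ((Commute.sub_left (Commute.refl _) (Commute.one_left _)).pow_pow _ _)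
      have hz : ((shift (1 : Fin p) - 1) ^ (j + 1) * shift (1 : Fin p) ^ k) v = 0 := by
        rw [hcomm.eq, Module.End.mul_apply, hv, map_zero]
      have hsplit : (shift (1 : Fin p) - 1) ^ j * shift (1 : Fin p) ^ (k + 1)
          = (shift (1 : Fin p) - 1) ^ (j + 1) * shift (1 : Fin p) ^ k
            + (shift (1 : Fin p) - 1) ^ j * shift (1 : Fin p) ^ k := by
        rw [pow_succ' (shift (1 : Fin p)) k, pow_succ (shift (1 : Fin p) - 1) j,
          mul_assoc, ← mul_add, sub_mul, one_mul, sub_add_cancel]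
      rw [hsplit, LinearMap.add_apply, hz, ih, zero_add]
  have hc := key c.val
  rwa [Module.End.mul_apply, shift_one_pow, Fin.ofNat_val_eq_self] at hc

/-- The exponents of `a` in the sections of an element of the first level stabilizer whose
sections have directed parts `M`. -/
def rootedExponent (M : Fin p → Fin (p - 1) → ZMod p) : Fin p → ZMod p :=
  ∑ y, shift (y + 1) (extend (M y))

lemma rootedExponent_apply (M : Fin p → Fin (p - 1) → ZMod p) (x : Fin p) :
    rootedExponent M x = ∑ y, extend (M y) (x - (y + 1)) := by
  simp [rootedExponent, shift_apply]

lemma rootedExponent_zero : rootedExponent (0 : Fin p → Fin (p - 1) → ZMod p) = 0 := by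
  simp [rootedExponent]

lemma rootedExponent_add (M N : Fin p → Fin (p - 1) → ZMod p) :
    rootedExponent (M + N) = rootedExponent M + rootedExponent N := by
  simp [rootedExponent, Finset.sum_add_distrib]

lemma rootedExponent_neg (M : Fin p → Fin (p - 1) → ZMod p) :
    rootedExponent (-M) = -rootedExponent M := by
  simp [rootedExponent]

lemma rootedExponent_comp_add (M : Fin p → Fin (p - 1) → ZMod p) (c x : Fin p) :
    rootedExponent (fun y => M (y + c)) x = rootedExponent M (x + c) := by
  rw [rootedExponent_apply, rootedExponent_apply]
  refine Fintype.sum_equiv (Equiv.addRight c) _ _ fun y => ?_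
  rw [Equiv.coe_addRight, show x + c - (y + c + 1) = x - (y + 1) by abel]

/-- If the vectors `M y` lie in `W` and all the exponents `rootedExponent M` vanish, then the sum
of the `M y` lies in a subspace of smaller dimension (or `W` is trivial). -/
lemma exists_smaller_submodule [Fact p.Prime] (W : Submodule (ZMod p) (Fin (p - 1) → ZMod p)) :
    ∃ W' : Submodule (ZMod p) (Fin (p - 1) → ZMod p),
      Module.finrank (ZMod p) W' ≤ Module.finrank (ZMod p) W - 1 ∧
      ∀ M : Fin p → Fin (p - 1) → ZMod p, (∀ y, M y ∈ W) → rootedExponent M = 0 →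
        ∑ y, M y ∈ W' := by
  classical
  by_cases hW : W = ⊥
  · refine ⟨⊥, by simp, fun M hM _ => ?_⟩
    subst hW
    exact Submodule.sum_mem _ fun y _ => hM y
  let K : ℕ → Submodule (ZMod p) (Fin (p - 1) → ZMod p) := fun j =>
    LinearMap.ker (((shift (1 : Fin p) - 1) ^ j) ∘ₗ extend)
  have hex : ∃ j, W ≤ K j := ⟨p, fun u _ => by simp [K, shift_sub_one_pow_card]⟩
  obtain ⟨j, hj⟩ : ∃ j, Nat.find hex = j + 1 := by
    refine Nat.exists_eq_succ_of_ne_zero fun h0 => hW ?_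
    have h := Nat.find_spec hex
    rw [h0] at h
    refine (Submodule.eq_bot_iff _).mpr fun u hu => extend_eq_zero ?_
    simpa [K] using h hu
  have hle : W ≤ K (j + 1) := hj ▸ Nat.find_spec hex
  have hnot : ¬ W ≤ K j := Nat.find_min hex (by omega)
  refine ⟨W ⊓ K j, ?_, fun M hM h0 => ⟨Submodule.sum_mem _ fun y _ => hM y, ?_⟩⟩
  · have hlt : W ⊓ K j < W := inf_le_left.lt_of_ne fun h => hnot (inf_eq_left.mp h)
    have := Submodule.finrank_lt_finrank_of_lt hlt
    omega
  · have h := congrArg (⇑((shift (1 : Fin p) - 1) ^ j)) h0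
    rw [rootedExponent, map_sum, map_zero] at h
    change ((shift (1 : Fin p) - 1) ^ j) (extend (∑ y, M y)) = 0
    rw [map_sum, map_sum, ← h]
    exact Finset.sum_congr rfl fun y _ => (shift_sub_one_pow_shift (hle (hM y)) _).symm

end Shift

/-! ### Exponents of words in the generators -/

section Exponents

variable {p r : ℕ} {e : Fin r → Fin (p - 1) → ZMod p}

/-- `HasExponents e g n u` says that `g` is the value of a word in the generators of
`multiGGS p e` in which `a` has total exponent `n` and the directed generators have total
exponents `m i` with `∑ i, m i • e i = u`. -/
inductive HasExponents (e : Fin r → Fin (p - 1) → ZMod p) :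
    AutT p → ZMod p → (Fin (p - 1) → ZMod p) → Prop
  | one : HasExponents e 1 0 0
  | rooted : HasExponents e (rootedA p) 1 0
  | directed (i : Fin r) : HasExponents e (directed (e i)) 0 (e i)
  | mul {f g : AutT p} {m n : ZMod p} {u v : Fin (p - 1) → ZMod p} :
      HasExponents e f m u → HasExponents e g n v → HasExponents e (f * g) (m + n) (u + v)
  | inv {f : AutT p} {m : ZMod p} {u : Fin (p - 1) → ZMod p} :
      HasExponents e f m u → HasExponents e f⁻¹ (-m) (-u)

lemma rootedA_mem_multiGGS : rootedA p ∈ multiGGS p e :=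
  subset_closure (Or.inl rfl)

lemma directed_mem_multiGGS (i : Fin r) : directed (e i) ∈ multiGGS p e :=
  subset_closure (Or.inr ⟨i, rfl⟩)

lemma exists_hasExponents {g : AutT p} (hg : g ∈ multiGGS p e) :
    ∃ n u, HasExponents e g n u := by
  induction hg using closure_induction with
  | mem x hx =>
    obtain rfl | ⟨i, rfl⟩ := hx
    · exact ⟨1, 0, .rooted⟩
    · exact ⟨0, e i, .directed i⟩
  | one => exact ⟨0, 0, .one⟩
  | mul x y _ _ hx hy =>
    obtain ⟨m, u, hx⟩ := hx
    obtain ⟨n, v, hy⟩ := hy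
    exact ⟨m + n, u + v, hx.mul hy⟩
  | inv x _ hx =>
    obtain ⟨m, u, hx⟩ := hx
    exact ⟨-m, -u, hx.inv⟩

namespace HasExponents

variable {g : AutT p} {n : ZMod p} {u : Fin (p - 1) → ZMod p}

lemma mem_multiGGS (h : HasExponents e g n u) : g ∈ multiGGS p e := by
  induction h with
  | one => exact one_mem _
  | rooted => exact rootedA_mem_multiGGS
  | directed i => exact directed_mem_multiGGS i
  | mul _ _ hf hg => exact mul_mem hf hg
  | inv _ hf => exact inv_mem hf

lemma mem_span (h : HasExponents e g n u) :
    u ∈ Submodule.span (ZMod p) (Set.range e) := by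
  induction h with
  | one => exact zero_mem _
  | rooted => exact zero_mem _
  | directed i => exact Submodule.subset_span ⟨i, rfl⟩
  | mul _ _ hf hg => exact add_mem hf hg
  | inv _ hf => exact neg_mem hf

lemma rootedA_pow (k : ℕ) : HasExponents e (rootedA p ^ k) k 0 := by
  induction k with
  | zero => simpa using HasExponents.one (e := e)
  | succ k ih =>
    rw [pow_succ, Nat.cast_succ, ← add_zero (0 : Fin (p - 1) → ZMod p)]
    exact ih.mul .rooted

variable [NeZero p]

lemma nil_apply (h : HasExponents e g n u) (x : Fin p) :
    g [] x = x + (ZMod.finEquiv p).symm n := by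
  induction h generalizing x with
  | one => simp [one_apply]
  | rooted => simp [rootedA, AutT.rooted]
  | directed i => simp [directed_nil]
  | mul _ _ hf hg =>
    rw [mul_apply, act_nil, Equiv.Perm.mul_apply, hg, hf, map_add]
    abel
  | inv _ hf =>
    rw [inv_nil, Equiv.Perm.inv_eq_iff_eq, hf, map_neg]
    abel

lemma eq_zero_of_mem_levelStab {k : ℕ} (h : HasExponents e g n u)
    (hg : g ∈ levelStab p (k + 1)) : n = 0 := by
  have h0 := h.nil_apply 0
  rw [nil_eq_one_of_mem_levelStab hg, Equiv.Perm.one_apply, zero_add] at h0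
  simpa using h0.symm

lemma exists_sections (h : HasExponents e g n u) :
    ∃ M : Fin p → Fin (p - 1) → ZMod p, ∑ x, M x = u ∧
      ∀ x, HasExponents e (sections g x) (rootedExponent M x) (M x) := by
  induction h with
  | one =>
    refine ⟨0, by simp, fun x => ?_⟩
    rw [rootedExponent_zero]
    exact .one
  | rooted =>
    refine ⟨0, by simp, fun x => ?_⟩
    rw [rootedExponent_zero, rootedA, sections_rooted]
    exact .one
  | directed i =>
    have hlast (x : Fin p) : x = -1 ↔ ¬ (x : ℕ) < p - 1 := by
      obtain ⟨q, rfl⟩ := Nat.exists_eq_succ_of_ne_zero (NeZero.ne p)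
      have hq : (-1 : Fin q.succ) = Fin.last q :=
        neg_eq_iff_add_eq_zero.mpr ((add_comm _ _).trans (Fin.last_add_one q))
      rw [hq, Fin.ext_iff, Fin.val_last]
      have := x.isLt
      omega
    refine ⟨Pi.single (-1) (e i), by simp, fun x => ?_⟩
    have hexp : rootedExponent (Pi.single (-1) (e i)) x = extend (e i) x := by
      rw [rootedExponent_apply, Finset.sum_eq_single (-1)]
      · simp
      · intro y _ hy
        simp [Pi.single_eq_of_ne hy]
      · simp
    rw [hexp]
    by_cases hx : (x : ℕ) < p - 1
    · rw [sections_directed_of_lt _ x hx, extend_of_lt _ x hx,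
        Pi.single_eq_of_ne (fun hx' => (hlast x).mp hx' hx)]
      simpa using rootedA_pow (e := e) (e i ⟨x, hx⟩).val
    · rw [sections_directed_of_not_lt _ x hx, extend_of_not_lt _ x hx, (hlast x).mpr hx,
        Pi.single_eq_same]
      exact .directed i
  | @mul f g m n u v _ hg ihf ihg =>
    obtain ⟨M, rfl, hM⟩ := ihf
    obtain ⟨N, rfl, hN⟩ := ihg
    refine ⟨(fun y => M (y + (ZMod.finEquiv p).symm n)) + N, ?_, fun x => ?_⟩
    · simp only [Pi.add_apply, Finset.sum_add_distrib]
      congr 1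
      exact Fintype.sum_equiv (Equiv.addRight _) _ _ fun _ => rfl
    · rw [rootedExponent_add, Pi.add_apply, Pi.add_apply, rootedExponent_comp_add,
        sections_mul, hg.nil_apply]
      exact (hM _).mul (hN x)
  | @inv f m u hf ihf =>
    obtain ⟨M, rfl, hM⟩ := ihf
    refine ⟨-(fun y => M (y + (ZMod.finEquiv p).symm (-m))), ?_, fun x => ?_⟩
    · simp only [Pi.neg_apply, Finset.sum_neg_distrib]
      congr 1
      exact Fintype.sum_equiv (Equiv.addRight _) _ _ fun _ => rfl
    · rw [rootedExponent_neg, Pi.neg_apply, Pi.neg_apply, rootedExponent_comp_add,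
        sections_inv, ← inv_nil, hf.inv.nil_apply]
      exact (hM _).inv

lemma abelianization_of_eq (h : HasExponents e g n u) :
    ∃ (hg : g ∈ multiGGS p e) (hu : AutT.directed u ∈ multiGGS p e),
      Abelianization.of (⟨g, hg⟩ : multiGGS p e) =
        Abelianization.of (⟨rootedA p ^ n.val, pow_mem rootedA_mem_multiGGS _⟩ : multiGGS p e) *
          Abelianization.of (⟨AutT.directed u, hu⟩ : multiGGS p e) := by
  induction h with
  | one =>
    refine ⟨one_mem _, directed_zero (p := p) ▸ one_mem _, ?_⟩
    rw [← map_mul]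
    congr 1
    ext1
    simp [directed_zero]
  | rooted =>
    refine ⟨rootedA_mem_multiGGS, directed_zero (p := p) ▸ one_mem _, ?_⟩
    rw [← map_mul]
    congr 1
    ext1
    change rootedA p = rootedA p ^ (1 : ZMod p).val * AutT.directed 0
    rw [directed_zero, mul_one, AutT.rootedA_pow, rootedA]
    congr 1
    ext1 x
    rw [finRotate_pow_val_apply, finRotate_apply, map_one]
  | directed i =>
    refine ⟨directed_mem_multiGGS i, directed_mem_multiGGS i, ?_⟩
    rw [← map_mul]
    congr 1
    ext1
    simp
  | mul _ _ ihf ihg =>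
    obtain ⟨hf, hu, h₁⟩ := ihf
    obtain ⟨hg, hv, h₂⟩ := ihg
    refine ⟨mul_mem hf hg, directed_add (p := p) _ _ ▸ mul_mem hu hv, ?_⟩
    simp only [directed_add, rootedA_pow_val_add]
    have h := congrArg₂ (· * ·) h₁ h₂
    rw [mul_mul_mul_comm, ← map_mul, ← map_mul, ← map_mul] at h
    exact h
  | inv _ ihf =>
    obtain ⟨hf, hu, h₁⟩ := ihf
    refine ⟨inv_mem hf, directed_neg (p := p) _ ▸ inv_mem hu, ?_⟩
    have h₂ := congrArg Inv.inv h₁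
    rw [mul_inv, ← map_inv, ← map_inv, ← map_inv] at h₂
    simp only [directed_neg, rootedA_pow_val_neg]
    exact h₂

lemma mem_commutator (h : HasExponents e g 0 0) : g ∈ ⁅multiGGS p e, multiGGS p e⁆ := by
  obtain ⟨hg, hu, h⟩ := h.abelianization_of_eq
  rw [← map_mul] at h
  have h1 : Abelianization.of (⟨g, hg⟩ : multiGGS p e) = 1 := by
    rw [h, ← map_one Abelianization.of]
    congr 1
    ext1
    simp [directed_zero]
  rw [← map_subtype_commutator]
  exact ⟨⟨g, hg⟩, by simpa [← Abelianization.ker_of] using h1, rfl⟩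

end HasExponents

/-- Elements of `st_G(k + 1)` have directed exponents in a subspace of dimension at most
`r - k`. -/
lemma exists_submodule_of_mem_levelStab [Fact p.Prime] (e : Fin r → Fin (p - 1) → ZMod p)
    (k : ℕ) :
    ∃ W : Submodule (ZMod p) (Fin (p - 1) → ZMod p), Module.finrank (ZMod p) W ≤ r - k ∧
      ∀ g n u, HasExponents e g n u → g ∈ levelStab p (k + 1) → u ∈ W := by
  induction k with
  | zero =>
    refine ⟨Submodule.span (ZMod p) (Set.range e), ?_, fun g n u h _ => h.mem_span⟩
    simpa [Set.finrank] using finrank_range_le_card (R := ZMod p) e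
  | succ k ih =>
    obtain ⟨W, hW, hmem⟩ := ih
    obtain ⟨W', hW', hsum⟩ := exists_smaller_submodule W
    refine ⟨W', by omega, fun g n u h hg => ?_⟩
    obtain ⟨M, rfl, hM⟩ := h.exists_sections
    exact hsum M (fun y => hmem _ _ _ (hM y) (sections_mem_levelStab hg y))
      (funext fun x => (hM x).eq_zero_of_mem_levelStab (sections_mem_levelStab hg x))

lemma levelStab_inf_multiGGS_le_commutator [Fact p.Prime] (e : Fin r → Fin (p - 1) → ZMod p) :
    levelStab p (r + 1) ⊓ multiGGS p e ≤ ⁅multiGGS p e, multiGGS p e⁆ := by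
  rintro g ⟨hst, hg⟩
  obtain ⟨n, u, h⟩ := exists_hasExponents hg
  obtain ⟨W, hW, hmem⟩ := exists_submodule_of_mem_levelStab e r
  have hbot : W = ⊥ := Submodule.finrank_eq_zero.mp (by omega)
  obtain rfl : n = 0 := h.eq_zero_of_mem_levelStab hst
  obtain rfl : u = 0 := by simpa [hbot] using hmem _ _ _ h hst
  exact h.mem_commutator

lemma sections_mem_multiGGS [NeZero p] {g : AutT p} (hg : g ∈ multiGGS p e) (x : Fin p) :
    sections g x ∈ multiGGS p e := by
  obtain ⟨n, u, h⟩ := exists_hasExponents hg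
  obtain ⟨M, -, hM⟩ := h.exists_sections
  exact (hM x).mem_multiGGS

end Exponents

end AutT

end TreeAut

/-- For a multi-GGS-group with `r ≥ 2`, `ψ₂(st_G(r+3))` is contained in
`st_G(r+1) × ⋯ × st_G(r+1)` (`p²` factors), and consequently in
`G' × ⋯ × G'`. -/
theorem psi2_stab_le
    (p r : ℕ) (hp : p.Prime) (hpodd : Odd p) (hr : 2 ≤ r)
    (e : Fin r → Fin (p - 1) → ZMod p) (he : LinearIndependent (ZMod p) e) :
    ∀ f ∈ (levelStab p (r + 3) ⊓ multiGGS p e : Subgroup (AutT p)),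
      (∀ x y : Fin p, sections2 f x y ∈ (levelStab p (r + 1) ⊓ multiGGS p e : Subgroup (AutT p))) ∧
      (∀ x y : Fin p, sections2 f x y ∈ ⁅multiGGS p e, multiGGS p e⁆) := by
  have : Fact p.Prime := ⟨hp⟩
  rintro f ⟨hst, hf⟩
  have hmem : ∀ x y : Fin p,
      sections2 f x y ∈ (levelStab p (r + 1) ⊓ multiGGS p e : Subgroup (AutT p)) := fun x y =>
    ⟨sections_mem_levelStab (sections_mem_levelStab hst x) y,
      sections_mem_multiGGS (sections_mem_multiGGS hf x) y⟩
  exact ⟨hmem, fun x y => levelStab_inf_multiGGS_le_commutator e (hmem x y)⟩
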